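/- arXiv:1506.04933 — 3 statements merged into one kernel-verified Lean document; each statement's English description precedes it below -/
import Mathlib

section
/- (Chain rule for the weighted entropy.) Let f be a probability density on ℝ^n, with marginal densities f(x_1,…,x_i) = ∫_{ℝ^{n−i}} f(x_1,…,x_n) dx_{i+1}⋯dx_n and conditional densities f(x_i | x_1,…,x_{i−1}) = f(x_1,…,x_i)/f(x_1,…,x_{i−1}) wherever the denominator is positive. Fix real constants a_1,…,a_n and let φ(x) = ∏_{i=1}^n (x_i − a_i)². For 1 ≤ i ≤ n−1 define ψ_i(x_1,…,x_i) = ∏_{j=1}^i (x_j − a_j)² · ∫_{ℝ^{n−i}} ∏_{k=i+1}^n (x_k − a_k)² · (f(x_1,…,x_n)/f(x_1,…,x_i)) dx_{i+1}⋯dx_n. Then, assuming all integrals involved converge absolutely, H^w_φ(X_1,…,X_n) = H^w_φ(X_n | X_1,…,X_{n−1}) + Σ_{i=1}^{n−1} H^w_{ψ_i}(X_i | X_1,…,X_{i−1}), where H^w_φ(X_1,…,X_n) = −∫_{ℝ^n} φ(x) f(x) log f(x) dx, H^w_ψ(X_i | X_1,…,X_{i−1}) = −∫_{ℝ^i} ψ(x_1,…,x_i)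 f(x_1,…,x_i) log f(x_i | x_1,…,x_{i−1}) dx_1⋯dx_i (for i = 1 this is −∫ ψ_1(x_1) f(x_1) log f(x_1) dx_1), and H^w_φ(X_n | X_1,…,X_{n−1}) = −∫_{ℝ^n} φ(x) f(x) log f(x_n | x_1,…,x_{n−1}) dx. -/
open MeasureTheory Finset

/-- Combine values of the first `i` coordinates (taken from `x`) with values of the
remaining coordinates (taken from `z`). -/
noncomputable def splice (n i : ℕ) (x : Fin n → ℝ)
    (z : {k : Fin n // ¬ (k : ℕ) < i} → ℝ) : Fin n → ℝ :=
  fun k => if h : (k : ℕ) < i then x k else z ⟨k, h⟩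

/-- The marginal density `f(x_1,…,x_i)` of the first `i` coordinates of the density `f`
(it depends only on the coordinates `x_k` with `k < i`). -/
noncomputable def marginal (n : ℕ) (f : (Fin n → ℝ) → ℝ) (i : ℕ) (x : Fin n → ℝ) : ℝ :=
  ∫ z : {k : Fin n // ¬ (k : ℕ) < i} → ℝ, f (splice n i x z)

/-- Extend a vector of the first `i` coordinates by zeros to a full vector. -/
noncomputable def embedHead (n i : ℕ) (u : {k : Fin n // (k : ℕ) < i} → ℝ) : Fin n → ℝ :=
  fun k => if h : (k : ℕ) < i then u ⟨k, h⟩ else 0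

/-- The weight function
`ψ_i(x_1,…,x_i) = ∏_{j≤i} (x_j−a_j)² ∫ ∏_{k>i} (x_k−a_k)² f(x)/f(x_1,…,x_i) dx_{i+1}⋯dx_n`
(as a function of a full vector, depending only on the first `i` coordinates). -/
noncomputable def psiWF (n : ℕ) (f : (Fin n → ℝ) → ℝ) (a : Fin n → ℝ) (i : ℕ)
    (x : Fin n → ℝ) : ℝ :=
  (∏ j : {k : Fin n // (k : ℕ) < i}, (x j.1 - a j.1) ^ 2) *
    ∫ z : {k : Fin n // ¬ (k : ℕ) < i} → ℝ,
      (∏ k : {k : Fin n // ¬ (k : ℕ) < i}, (z k - a k.1) ^ 2) *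
        (f (splice n i x z) / marginal n f i x)

section WeightedEntropy

variable {n : ℕ} {f : (Fin n → ℝ) → ℝ}

lemma marginal_congr (f : (Fin n → ℝ) → ℝ) {i : ℕ} {x y : Fin n → ℝ}
    (h : ∀ k : Fin n, (k : ℕ) < i → x k = y k) :
    marginal n f i x = marginal n f i y := by
  have hs : splice n i x = splice n i y := by
    funext z k
    by_cases hk : (k : ℕ) < i <;> simp [splice, hk, h]
  simp only [marginal, hs]

lemma measurable_splice (n i : ℕ) :
    Measurable fun p : (Fin n → ℝ) × ({k : Fin n // ¬ (k : ℕ) < i} → ℝ) =>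
      splice n i p.1 p.2 := by
  refine measurable_pi_lambda _ fun k => ?_
  by_cases hk : (k : ℕ) < i
  · simp only [splice, hk, dite_true]
    fun_prop
  · simp only [splice, hk, dite_false]
    fun_prop

lemma measurable_marginal (hf : Measurable f) (i : ℕ) : Measurable (marginal n f i) :=
  (StronglyMeasurable.integral_prod_right
    (f := fun x z => f (splice n i x z))
    (hf.comp (measurable_splice n i)).stronglyMeasurable).measurable

/-- Splitting `ℝⁿ` into the first `i` coordinates and the remaining ones. -/
noncomputable abbrev headTail (n i : ℕ) :=
  MeasurableEquiv.piEquivPiSubtypeProd (fun _ : Fin n => ℝ) (fun k : Fin n => (k : ℕ) < i)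

lemma measurePreserving_headTail_symm (n i : ℕ) :
    MeasurePreserving (headTail n i).symm :=
  (volume_preserving_piEquivPiSubtypeProd (fun _ : Fin n => ℝ)
    (fun k : Fin n => (k : ℕ) < i)).symm

lemma headTail_symm_apply (i : ℕ) (u : {k : Fin n // (k : ℕ) < i} → ℝ)
    (z : {k : Fin n // ¬ (k : ℕ) < i} → ℝ) :
    (headTail n i).symm (u, z) = splice n i (embedHead n i u) z := by
  funext k
  by_cases hk : (k : ℕ) < i <;>
    simp [splice, embedHead, hk, MeasurableEquiv.piEquivPiSubtypeProd,
      Equiv.piEquivPiSubtypeProd]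

lemma marginal_splice (f : (Fin n → ℝ) → ℝ) {i j : ℕ} (hji : j ≤ i) (x : Fin n → ℝ)
    (z : {k : Fin n // ¬ (k : ℕ) < i} → ℝ) :
    marginal n f j (splice n i x z) = marginal n f j x :=
  marginal_congr f fun k hk => by simp [splice, hk.trans_le hji]

lemma splice_ae_eq_zero_of_marginal_eq_zero (hf_nonneg : ∀ x, 0 ≤ f x) {i : ℕ} {x : Fin n → ℝ}
    (hint : Integrable fun z : {k : Fin n // ¬ (k : ℕ) < i} → ℝ => f (splice n i x z))
    (h : marginal n f i x = 0) :
    (fun z : {k : Fin n // ¬ (k : ℕ) < i} → ℝ => f (splice n i x z)) =ᵐ[volume] 0 :=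
  (integral_eq_zero_iff_of_nonneg (fun _ => hf_nonneg _) hint).1 h

lemma ae_eq_zero_of_marginal_eq_zero (hf_meas : Measurable f) (hf_nonneg : ∀ x, 0 ≤ f x) (i : ℕ)
    (hint : ∀ x : Fin n → ℝ,
      Integrable fun z : {k : Fin n // ¬ (k : ℕ) < i} → ℝ => f (splice n i x z)) :
    ∀ᵐ x : Fin n → ℝ, marginal n f i x = 0 → f x = 0 := by
  have hset : MeasurableSet {x : Fin n → ℝ | marginal n f i x = 0 → f x = 0} := by
    have h1 : MeasurableSet {x | marginal n f i x = 0} :=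
      measurable_marginal hf_meas i (measurableSet_singleton 0)
    have h2 : MeasurableSet {x | f x = 0} := hf_meas (measurableSet_singleton 0)
    exact h1.imp h2
  have hmp := measurePreserving_headTail_symm n i
  rw [← hmp.map_eq, ae_map_iff hmp.measurable.aemeasurable hset]
  refine (Measure.ae_prod_iff_ae_ae (hmp.measurable hset)).2 ?_
  refine Filter.Eventually.of_forall fun u => ?_
  change ∀ᵐ z, marginal n f i ((headTail n i).symm (u, z)) = 0 →
    f ((headTail n i).symm (u, z)) = 0
  simp only [headTail_symm_apply, marginal_splice f le_rfl]
  by_cases h : marginal n f i (embedHead n i u) = 0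
  · filter_upwards [splice_ae_eq_zero_of_marginal_eq_zero hf_nonneg (hint _) h] with z hz _
    exact hz
  · exact Filter.Eventually.of_forall fun z hz => absurd hz h

lemma marginal_zero (hf : Integrable f) (x : Fin n → ℝ) :
    marginal n f 0 x = ∫ y, f y := by
  have hmp := measurePreserving_headTail_symm n 0
  have hint : Integrable fun p => f ((headTail n 0).symm p) :=
    (hmp.integrable_comp_emb (headTail n 0).symm.measurableEmbedding).2 hf
  have hmarg (u : {k : Fin n // (k : ℕ) < 0} → ℝ) :
      ∫ z, f ((headTail n 0).symm (u, z)) = marginal n f 0 x := by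
    simp only [headTail_symm_apply]
    exact marginal_congr f fun k hk => absurd hk (Nat.not_lt_zero _)
  rw [← hmp.integral_comp' f, Measure.volume_eq_prod, integral_prod _ hint,
    integral_congr_ae (Filter.Eventually.of_forall hmarg), integral_const]
  have : IsEmpty {k : Fin n // (k : ℕ) < 0} := ⟨fun k => Nat.not_lt_zero _ k.2⟩
  simp [measureReal_def, volume_pi]

/-- Multiplying the conditional density by the marginal recovers the density, for almost every
tail, even where the marginal vanishes. -/
lemma tailWeight_ae_eq (hf_nonneg : ∀ x, 0 ≤ f x) (a : Fin n → ℝ) {i : ℕ} {x : Fin n → ℝ}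
    (hint : Integrable fun z : {k : Fin n // ¬ (k : ℕ) < i} → ℝ => f (splice n i x z)) :
    (fun z : {k : Fin n // ¬ (k : ℕ) < i} → ℝ =>
      (∏ k : {k : Fin n // ¬ (k : ℕ) < i}, (z k - a k.1) ^ 2) *
        (f (splice n i x z) / marginal n f i x) * marginal n f i x) =ᵐ[volume]
    fun z => (∏ k : {k : Fin n // ¬ (k : ℕ) < i}, (z k - a k.1) ^ 2) * f (splice n i x z) := by
  by_cases h : marginal n f i x = 0
  · filter_upwards [splice_ae_eq_zero_of_marginal_eq_zero hf_nonneg hint h] with z hz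
    have hz' : f (splice n i x z) = 0 := hz
    simp [hz']
  · filter_upwards with z
    rw [mul_assoc, div_mul_cancel₀ _ h]

lemma psiWF_mul_marginal (hf_nonneg : ∀ x, 0 ≤ f x) (a : Fin n → ℝ) {i : ℕ} {x : Fin n → ℝ}
    (hint : Integrable fun z : {k : Fin n // ¬ (k : ℕ) < i} → ℝ => f (splice n i x z)) :
    psiWF n f a i x * marginal n f i x =
      (∏ j : {k : Fin n // (k : ℕ) < i}, (x j.1 - a j.1) ^ 2) *
        ∫ z : {k : Fin n // ¬ (k : ℕ) < i} → ℝ,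
          (∏ k : {k : Fin n // ¬ (k : ℕ) < i}, (z k - a k.1) ^ 2) * f (splice n i x z) := by
  rw [← integral_congr_ae (tailWeight_ae_eq hf_nonneg a hint), integral_mul_const, ← mul_assoc,
    psiWF]

lemma prod_splice (a : Fin n → ℝ) (i : ℕ) (x : Fin n → ℝ)
    (z : {k : Fin n // ¬ (k : ℕ) < i} → ℝ) :
    ∏ k, (splice n i x z k - a k) ^ 2 =
      (∏ j : {k : Fin n // (k : ℕ) < i}, (x j.1 - a j.1) ^ 2) *
        ∏ k : {k : Fin n // ¬ (k : ℕ) < i}, (z k - a k.1) ^ 2 := by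
  rw [← Fintype.prod_subtype_mul_prod_subtype (fun k : Fin n => (k : ℕ) < i)]
  congr 1
  · exact Fintype.prod_congr _ _ fun j => by simp [splice, j.2]
  · exact Fintype.prod_congr _ _ fun j => by simp [splice, j.2]

/-- Integrating out the tail coordinates against a function `L` of the first `i` coordinates
replaces the full weight by `psiWF`. -/
lemma integrable_and_integral_weight_mul (hf_meas : Measurable f) (hf_nonneg : ∀ x, 0 ≤ f x)
    (a : Fin n → ℝ) (i : ℕ)
    (hmarg : ∀ x : Fin n → ℝ,
      Integrable fun z : {k : Fin n // ¬ (k : ℕ) < i} → ℝ => f (splice n i x z))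
    (hpsi : ∀ x : Fin n → ℝ,
      Integrable fun z : {k : Fin n // ¬ (k : ℕ) < i} → ℝ =>
        (∏ k : {k : Fin n // ¬ (k : ℕ) < i}, (z k - a k.1) ^ 2) *
          (f (splice n i x z) / marginal n f i x))
    {L : (Fin n → ℝ) → ℝ} (hL : Measurable L) (hL_head : ∀ x z, L (splice n i x z) = L x)
    (hterm : Integrable fun u : {k : Fin n // (k : ℕ) < i} → ℝ =>
      psiWF n f a i (embedHead n i u) * marginal n f i (embedHead n i u) * L (embedHead n i u)) :
    Integrable (fun x : Fin n → ℝ => (∏ k, (x k - a k) ^ 2) * f x * L x) ∧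
    ∫ x : Fin n → ℝ, (∏ k, (x k - a k) ^ 2) * f x * L x =
      ∫ u : {k : Fin n // (k : ℕ) < i} → ℝ,
        psiWF n f a i (embedHead n i u) * marginal n f i (embedHead n i u) *
          L (embedHead n i u) := by
  set G : (Fin n → ℝ) → ℝ := fun x => (∏ k, (x k - a k) ^ 2) * f x * L x with hG
  have hG_meas : Measurable G := by fun_prop
  have hmp := measurePreserving_headTail_symm n i
  have hG_split (u : {k : Fin n // (k : ℕ) < i} → ℝ) (z : {k : Fin n // ¬ (k : ℕ) < i} → ℝ) :
      G ((headTail n i).symm (u, z)) =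
        ((∏ j : {k : Fin n // (k : ℕ) < i}, (embedHead n i u j.1 - a j.1) ^ 2) *
          L (embedHead n i u)) *
        ((∏ k : {k : Fin n // ¬ (k : ℕ) < i}, (z k - a k.1) ^ 2) *
          f (splice n i (embedHead n i u) z)) := by
    rw [headTail_symm_apply]
    simp only [hG, prod_splice, hL_head]
    ring
  have htail (x : Fin n → ℝ) : Integrable fun z : {k : Fin n // ¬ (k : ℕ) < i} → ℝ =>
      (∏ k : {k : Fin n // ¬ (k : ℕ) < i}, (z k - a k.1) ^ 2) * f (splice n i x z) :=
    ((hpsi x).mul_const _).congr (tailWeight_ae_eq hf_nonneg a (hmarg x))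
  have hnonneg (x : Fin n → ℝ) (z : {k : Fin n // ¬ (k : ℕ) < i} → ℝ) :
      0 ≤ (∏ k : {k : Fin n // ¬ (k : ℕ) < i}, (z k - a k.1) ^ 2) * f (splice n i x z) :=
    mul_nonneg (Finset.prod_nonneg fun _ _ => sq_nonneg _) (hf_nonneg _)
  have hG_int : Integrable (G ∘ (headTail n i).symm) := by
    rw [Measure.volume_eq_prod, integrable_prod_iff
      (hG_meas.comp (headTail n i).symm.measurable).aestronglyMeasurable]
    simp only [Function.comp_apply, hG_split]
    refine ⟨Filter.Eventually.of_forall fun u => (htail _).const_mul _, ?_⟩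
    refine hterm.norm.congr (Filter.Eventually.of_forall fun u => ?_)
    simp only [norm_mul _ (_ * f _), integral_const_mul, Real.norm_of_nonneg (hnonneg _ _)]
    rw [psiWF_mul_marginal hf_nonneg a (hmarg _), mul_right_comm, norm_mul,
      Real.norm_of_nonneg (integral_nonneg (hnonneg _))]
  have hG_int' : Integrable G :=
    (hmp.integrable_comp_emb (headTail n i).symm.measurableEmbedding).1 hG_int
  refine ⟨hG_int', ?_⟩
  rw [← hmp.integral_comp' G, Measure.volume_eq_prod,
    integral_prod (fun p => G ((headTail n i).symm p)) hG_int]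
  refine integral_congr_ae (Filter.Eventually.of_forall fun u => ?_)
  simp only [hG_split, integral_const_mul]
  rw [psiWF_mul_marginal hf_nonneg a (hmarg _), mul_right_comm]

lemma log_eq_sum_log_div {m : ℕ → ℝ} (h0 : m 0 = 1) (N : ℕ) (hm : ∀ i ≤ N, m i ≠ 0) :
    Real.log (m N) = ∑ i ∈ Finset.Icc 1 N, Real.log (m i / m (i - 1)) := by
  induction N with
  | zero => simp [h0]
  | succ N ih =>
    rw [Finset.sum_Icc_succ_top (by omega), ← ih fun i hi => hm i (by omega),
      Nat.add_sub_cancel, Real.log_div (hm _ le_rfl) (hm _ (by omega))]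
    ring

end WeightedEntropy

/-- **Chain rule for the weighted entropy** with central-moments weight function
`φ(x) = ∏_{i=1}^n (x_i − a_i)²`:
`H^w_φ(X_1,…,X_n) = H^w_φ(X_n|X_1,…,X_{n−1}) + Σ_{i=1}^{n−1} H^w_{ψ_i}(X_i|X_1,…,X_{i−1})`,
where the conditional density `f(x_i|x_1,…,x_{i−1})` is the ratio of consecutive marginals. -/
theorem weighted_entropy_chain_rule {n : ℕ} (hn : 1 ≤ n)
    (f : (Fin n → ℝ) → ℝ) (a : Fin n → ℝ)
    (hf_meas : Measurable f) (hf_nonneg : ∀ x, 0 ≤ f x)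
    (hf_int : Integrable f) (hf_one : ∫ x, f x = 1)
    -- absolute convergence of all the integrals involved
    (hmarg : ∀ (i : ℕ) (x : Fin n → ℝ),
      Integrable fun z : {k : Fin n // ¬ (k : ℕ) < i} → ℝ => f (splice n i x z))
    (hpsi : ∀ (i : ℕ) (x : Fin n → ℝ),
      Integrable fun z : {k : Fin n // ¬ (k : ℕ) < i} → ℝ =>
        (∏ k : {k : Fin n // ¬ (k : ℕ) < i}, (z k - a k.1) ^ 2) *
          (f (splice n i x z) / marginal n f i x))
    (hjoint : Integrable fun x : Fin n → ℝ =>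
      (∏ i, (x i - a i) ^ 2) * f x * Real.log (f x))
    (hcond : Integrable fun x : Fin n → ℝ =>
      (∏ i, (x i - a i) ^ 2) * f x * Real.log (f x / marginal n f (n - 1) x))
    (hterm : ∀ i ∈ Finset.Icc 1 (n - 1),
      Integrable fun u : {k : Fin n // (k : ℕ) < i} → ℝ =>
        psiWF n f a i (embedHead n i u) * marginal n f i (embedHead n i u) *
          Real.log (marginal n f i (embedHead n i u) /
            marginal n f (i - 1) (embedHead n i u))) :
    (- ∫ x : Fin n → ℝ, (∏ i, (x i - a i) ^ 2) * f x * Real.log (f x))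
      = (- ∫ x : Fin n → ℝ, (∏ i, (x i - a i) ^ 2) * f x *
            Real.log (f x / marginal n f (n - 1) x))
        + ∑ i ∈ Finset.Icc 1 (n - 1),
            (- ∫ u : {k : Fin n // (k : ℕ) < i} → ℝ,
                psiWF n f a i (embedHead n i u) * marginal n f i (embedHead n i u) *
                  Real.log (marginal n f i (embedHead n i u) /
                    marginal n f (i - 1) (embedHead n i u))) := by
  have hlog (i : ℕ) (hi : i ∈ Finset.Icc 1 (n - 1)) :=
    integrable_and_integral_weight_mul hf_meas hf_nonneg a i (hmarg i) (hpsi i)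
      (L := fun x => Real.log (marginal n f i x / marginal n f (i - 1) x))
      (((measurable_marginal hf_meas i).div (measurable_marginal hf_meas (i - 1))).log)
      (fun x z => by
        simp only [marginal_splice f le_rfl, marginal_splice f (Nat.sub_le i 1)])
      (hterm i hi)
  have hae : ∀ᵐ x : Fin n → ℝ, ∀ i : ℕ, marginal n f i x = 0 → f x = 0 :=
    ae_all_iff.2 fun i => ae_eq_zero_of_marginal_eq_zero hf_meas hf_nonneg i (hmarg i)
  have hsplit : (fun x : Fin n → ℝ => (∏ i, (x i - a i) ^ 2) * f x * Real.log (f x)) =ᵐ[volume]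
      fun x => (∏ i, (x i - a i) ^ 2) * f x * Real.log (f x / marginal n f (n - 1) x) +
        ∑ i ∈ Finset.Icc 1 (n - 1), (∏ i, (x i - a i) ^ 2) * f x *
          Real.log (marginal n f i x / marginal n f (i - 1) x) := by
    filter_upwards [hae] with x hx
    by_cases hfx : f x = 0
    · simp [hfx]
    have hm (i : ℕ) : marginal n f i x ≠ 0 := fun h => hfx (hx i h)
    rw [← Finset.mul_sum, ← log_eq_sum_log_div (m := fun i => marginal n f i x)
      ((marginal_zero hf_int x).trans hf_one) (n - 1) fun i _ => hm i, Real.log_div hfx (hm _)]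
    ring
  rw [integral_congr_ae hsplit,
    integral_add hcond (integrable_finsetSum _ fun i hi => (hlog i hi).1),
    integral_finsetSum _ fun i hi => (hlog i hi).1,
    Finset.sum_congr rfl fun i hi => (hlog i hi).2, Finset.sum_neg_distrib, neg_add]
end

section
/- Let f be a probability density on ℝ^n with marginal densities f_j(x_j), and fix real constants a_1,…,a_n with φ(x) = ∏_{i=1}^n (x_i − a_i)². For 1 ≤ j ≤ n−1 define ψ'_j(x_j) = (x_j − a_j)² · ∫_{ℝ^{n−1}} ∏_{i≠j} (x_i − a_i)² · (f(x_1,…,x_n)/f_j(x_j)) ∏_{i≠j} dx_i. Then, assuming all integrals involved converge absolutely, the mutual weighted entropy satisfies I^w_φ(f, f_1⋯f_n) = Σ_{j=1}^{n−1} H^w_{ψ'_j}(f_j) − H^w_φ(X_1,…,X_{n−1} | X_n), where I^w_φ(f, f_1⋯f_n) = ∫_{ℝ^n} φ(x) f(x) log( f(x) / (f_1(x_1)⋯f_n(x_n)) ) dx, H^w_{ψ'_j}(f_j) = −∫_ℝ ψ'_j(x_j) f_j(x_j) log f_j(x_j) dx_j, and H^w_φ(X_1,…,X_{n−1} | X_n)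 = −∫_{ℝ^n} φ(x) f(x) log( f(x)/f_n(x_n) ) dx. -/
open MeasureTheory Finset

/-- The one-dimensional marginal density `f_j` of the `j`-th coordinate of a joint
density `f` on `ℝ^{n+1}`. -/
noncomputable def marg1 (n : ℕ) (f : (Fin (n + 1) → ℝ) → ℝ) (j : Fin (n + 1)) (t : ℝ) : ℝ :=
  ∫ z : {k : Fin (n + 1) // k ≠ j} → ℝ,
    f (fun k => if h : k = j then t else z ⟨k, h⟩)

/-- The weight function
`ψ'_j(x_j) = (x_j−a_j)² ∫ ∏_{i≠j}(x_i−a_i)² · f(x_1,…,x_n)/f_j(x_j) ∏_{i≠j} dx_i`. -/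
noncomputable def psi' (n : ℕ) (f : (Fin (n + 1) → ℝ) → ℝ) (a : Fin (n + 1) → ℝ)
    (j : Fin (n + 1)) (t : ℝ) : ℝ :=
  (t - a j) ^ 2 *
    ∫ z : {k : Fin (n + 1) // k ≠ j} → ℝ,
      (∏ i : {k : Fin (n + 1) // k ≠ j}, (z i - a i.1) ^ 2) *
        (f (fun k => if h : k = j then t else z ⟨k, h⟩) / marg1 n f j t)

/-- Inserting a real number as the `j`-th coordinate, as a measurable equivalence. -/
noncomputable def insertCoord {ι : Type*} [DecidableEq ι] (j : ι) :
    (ℝ × ({k : ι // k ≠ j} → ℝ)) ≃ᵐ (ι → ℝ) :=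
  ((MeasurableEquiv.funUnique {k : ι // k = j} ℝ).symm.prodCongr (MeasurableEquiv.refl _)).trans
    (MeasurableEquiv.piEquivPiSubtypeProd (fun _ : ι => ℝ) (fun k => k = j)).symm

lemma insertCoord_apply {ι : Type*} [DecidableEq ι] (j : ι)
    (p : ℝ × ({k : ι // k ≠ j} → ℝ)) :
    insertCoord j p = fun k => if h : k = j then p.1 else p.2 ⟨k, h⟩ := rfl

lemma measurePreserving_insertCoord {ι : Type*} [Fintype ι] [DecidableEq ι] (j : ι) :
    MeasurePreserving (insertCoord j) := by
  have h₁ := (volume_preserving_funUnique {k : ι // k = j} ℝ).symm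
  have h₂ := MeasurePreserving.id (volume : Measure ({k : ι // k ≠ j} → ℝ))
  have h₃ := (volume_preserving_piEquivPiSubtypeProd (fun _ : ι => ℝ) (fun k => k = j)).symm
  refine h₃.comp ?_
  convert! h₁.prod h₂
  rw [Measure.volume_eq_prod]
  congr!

lemma prod_insertCoord {ι : Type*} [Fintype ι] [DecidableEq ι] (j : ι) (a : ι → ℝ)
    (p : ℝ × ({k : ι // k ≠ j} → ℝ)) :
    ∏ i, (insertCoord j p i - a i) ^ 2 =
      (p.1 - a j) ^ 2 * ∏ i : {k : ι // k ≠ j}, (p.2 i - a i.1) ^ 2 := by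
  rw [Fintype.prod_eq_mul_prod_subtype_ne _ j]
  congr 1
  · simp [insertCoord_apply]
  · exact Finset.prod_congr rfl fun i _ => by simp [insertCoord_apply, i.2]

lemma measurable_marg1 {n : ℕ} {f : (Fin (n + 1) → ℝ) → ℝ} (hf : Measurable f)
    (j : Fin (n + 1)) : Measurable (marg1 n f j) :=
  (StronglyMeasurable.integral_prod_right' (ν := volume)
    (hf.comp (insertCoord j).measurable).stronglyMeasurable).measurable

/-- Where a marginal density vanishes, the joint density vanishes almost everywhere. -/
lemma ae_eq_zero_of_marg1_eq_zero {n : ℕ} {f : (Fin (n + 1) → ℝ) → ℝ} (hf : Measurable f)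
    (hf_nonneg : ∀ x, 0 ≤ f x) (j : Fin (n + 1))
    (hmarg : ∀ t : ℝ, Integrable fun z : {k : Fin (n + 1) // k ≠ j} → ℝ =>
        f (fun k => if h : k = j then t else z ⟨k, h⟩)) :
    ∀ᵐ x, marg1 n f j (x j) = 0 → f x = 0 := by
  have hm : MeasurableSet {x : Fin (n + 1) → ℝ | marg1 n f j (x j) = 0 → f x = 0} := by
    have h₁ : MeasurableSet {x : Fin (n + 1) → ℝ | marg1 n f j (x j) = 0} :=
      ((measurable_marg1 hf j).comp (measurable_pi_apply j)) (measurableSet_singleton 0)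
    exact h₁.imp (hf (measurableSet_singleton 0))
  rw [← (measurePreserving_insertCoord j).map_eq,
    ae_map_iff (insertCoord j).measurable.aemeasurable hm, Measure.volume_eq_prod]
  refine (Measure.ae_prod_iff_ae_ae ((insertCoord j).measurable hm)).2 (.of_forall fun t => ?_)
  by_cases ht : marg1 n f j t = 0
  · filter_upwards [(integral_eq_zero_iff_of_nonneg (fun _ => hf_nonneg _) (hmarg t)).1 ht]
      with z hz _ using hz
  · exact .of_forall fun z h => absurd (by simpa [insertCoord_apply] using h) ht

/-- The weighted integral of `log f_j` over the joint density converges and reduces to a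
one-dimensional integral with the weight `psi'`. -/
lemma integrable_and_integral_mul_log_marg1 {n : ℕ} {f : (Fin (n + 1) → ℝ) → ℝ}
    {a : Fin (n + 1) → ℝ} (hf : Measurable f) (hf_nonneg : ∀ x, 0 ≤ f x) (j : Fin (n + 1))
    (hpsi : ∀ t : ℝ,
      Integrable fun z : {k : Fin (n + 1) // k ≠ j} → ℝ =>
        (∏ i : {k : Fin (n + 1) // k ≠ j}, (z i - a i.1) ^ 2) *
          (f (fun k => if h : k = j then t else z ⟨k, h⟩) / marg1 n f j t))
    (hH : Integrable fun t : ℝ =>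
      psi' n f a j t * marg1 n f j t * Real.log (marg1 n f j t)) :
    (Integrable fun x : Fin (n + 1) → ℝ =>
        (∏ i, (x i - a i) ^ 2) * f x * Real.log (marg1 n f j (x j))) ∧
      ∫ x : Fin (n + 1) → ℝ, (∏ i, (x i - a i) ^ 2) * f x * Real.log (marg1 n f j (x j)) =
        ∫ t : ℝ, psi' n f a j t * marg1 n f j t * Real.log (marg1 n f j t) := by
  set G : (Fin (n + 1) → ℝ) → ℝ := fun x =>
    (∏ i, (x i - a i) ^ 2) * f x * Real.log (marg1 n f j (x j)) with hG
  have hGm : Measurable G := by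
    have := (measurable_marg1 hf j).comp (measurable_pi_apply (X := fun _ => ℝ) j)
    refine Measurable.mul (Measurable.mul ?_ hf) this.log
    fun_prop
  have hslice (t : ℝ) (z : {k : Fin (n + 1) // k ≠ j} → ℝ) : G (insertCoord j (t, z)) =
      (t - a j) ^ 2 * marg1 n f j t * Real.log (marg1 n f j t) *
        ((∏ i : {k : Fin (n + 1) // k ≠ j}, (z i - a i.1) ^ 2) *
          (f (fun k => if h : k = j then t else z ⟨k, h⟩) / marg1 n f j t)) := by
    have hj : insertCoord j (t, z) j = t := by simp [insertCoord_apply]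
    simp only [hG, prod_insertCoord, hj]
    rw [insertCoord_apply]
    by_cases ht : marg1 n f j t = 0
    · simp [ht]
    · field_simp
  have hmarg_nonneg (t : ℝ) : 0 ≤ marg1 n f j t := integral_nonneg fun _ => hf_nonneg _
  have hint : Integrable (fun p => G (insertCoord j p)) := by
    rw [Measure.volume_eq_prod]
    refine (integrable_prod_iff
      (hGm.comp (insertCoord j).measurable).aestronglyMeasurable).2 ⟨.of_forall fun t => ?_, hH.norm.congr (.of_forall fun t => ?_)⟩
    · simpa only [Function.comp_apply, hslice] using (hpsi t).const_mul _
    · have hnn (z : {k : Fin (n + 1) // k ≠ j} → ℝ) :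
          0 ≤ (∏ i : {k : Fin (n + 1) // k ≠ j}, (z i - a i.1) ^ 2) *
            (f (fun k => if h : k = j then t else z ⟨k, h⟩) / marg1 n f j t) :=
        mul_nonneg (prod_nonneg fun _ _ => sq_nonneg _)
          (div_nonneg (hf_nonneg _) (hmarg_nonneg t))
      simp only [Function.comp_apply, hslice, norm_mul (_ * _ * Real.log _), Real.norm_of_nonneg (hnn _)]
      rw [integral_const_mul, psi']
      simp only [norm_mul, Real.norm_of_nonneg (integral_nonneg hnn)]
      ring
  have hmp := measurePreserving_insertCoord j
  refine ⟨(hmp.integrable_comp_emb (insertCoord j).measurableEmbedding).1 hint, ?_⟩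
  rw [← hmp.integral_comp (insertCoord j).measurableEmbedding]
  rw [Measure.volume_eq_prod, integral_prod _ hint]
  congr 1 with t
  simp only [hslice, integral_const_mul, psi']
  ring

/-- The mutual weighted entropy with weight `φ(x) = ∏_i (x_i − a_i)²` decomposes as
`I^w_φ(f, f_1⋯f_n) = Σ_{j=1}^{n−1} H^w_{ψ'_j}(f_j) − H^w_φ(X_1,…,X_{n−1}|X_n)`
(here the joint density has `n+1` coordinates, the sum runs over all coordinates
except the last one). -/
theorem mutual_weighted_entropy_decomposition {n : ℕ}
    (f : (Fin (n + 1) → ℝ) → ℝ) (a : Fin (n + 1) → ℝ)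
    (hf_meas : Measurable f) (hf_nonneg : ∀ x, 0 ≤ f x)
    (hf_int : Integrable f) (hf_one : ∫ x, f x = 1)
    -- absolute convergence of all the integrals involved
    (hmarg : ∀ (j : Fin (n + 1)) (t : ℝ),
      Integrable fun z : {k : Fin (n + 1) // k ≠ j} → ℝ =>
        f (fun k => if h : k = j then t else z ⟨k, h⟩))
    (hpsi : ∀ (j : Fin (n + 1)) (t : ℝ),
      Integrable fun z : {k : Fin (n + 1) // k ≠ j} → ℝ =>
        (∏ i : {k : Fin (n + 1) // k ≠ j}, (z i - a i.1) ^ 2) *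
          (f (fun k => if h : k = j then t else z ⟨k, h⟩) / marg1 n f j t))
    (hI : Integrable fun x : Fin (n + 1) → ℝ =>
      (∏ i, (x i - a i) ^ 2) * f x * Real.log (f x / ∏ i, marg1 n f i (x i)))
    (hH : ∀ j : Fin n, Integrable fun t : ℝ =>
      psi' n f a j.castSucc t * marg1 n f j.castSucc t * Real.log (marg1 n f j.castSucc t))
    (hcond : Integrable fun x : Fin (n + 1) → ℝ =>
      (∏ i, (x i - a i) ^ 2) * f x *
        Real.log (f x / marg1 n f (Fin.last n) (x (Fin.last n)))) :
    (∫ x : Fin (n + 1) → ℝ,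
        (∏ i, (x i - a i) ^ 2) * f x * Real.log (f x / ∏ i, marg1 n f i (x i)))
      = (∑ j : Fin n, - ∫ t : ℝ,
            psi' n f a j.castSucc t * marg1 n f j.castSucc t *
              Real.log (marg1 n f j.castSucc t))
        - (- ∫ x : Fin (n + 1) → ℝ,
              (∏ i, (x i - a i) ^ 2) * f x *
                Real.log (f x / marg1 n f (Fin.last n) (x (Fin.last n)))) := by
  have key (j : Fin n) := integrable_and_integral_mul_log_marg1 hf_meas hf_nonneg j.castSucc
    (hpsi j.castSucc) (hH j)
  have hae : ∀ᵐ x, ∀ j, marg1 n f j (x j) = 0 → f x = 0 :=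
    ae_all_iff.2 fun j => ae_eq_zero_of_marg1_eq_zero hf_meas hf_nonneg j (hmarg j)
  have hpt : ∀ᵐ x : Fin (n + 1) → ℝ,
      (∏ i, (x i - a i) ^ 2) * f x * Real.log (f x / ∏ i, marg1 n f i (x i)) =
        (∏ i, (x i - a i) ^ 2) * f x *
            Real.log (f x / marg1 n f (Fin.last n) (x (Fin.last n))) -
          ∑ j : Fin n, (∏ i, (x i - a i) ^ 2) * f x *
            Real.log (marg1 n f j.castSucc (x j.castSucc)) := by
    filter_upwards [hae] with x hx
    by_cases h0 : f x = 0
    · simp [h0]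
    have hm (j : Fin (n + 1)) : marg1 n f j (x j) ≠ 0 := fun h => h0 (hx j h)
    rw [Real.log_div h0 (prod_ne_zero_iff.2 fun j _ => hm j), Real.log_div h0 (hm _),
      Real.log_prod fun j _ => hm j, Fin.sum_univ_castSucc, ← mul_sum]
    ring
  rw [integral_congr_ae hpt, integral_sub hcond (integrable_finsetSum _ fun j _ => (key j).1),
    integral_finsetSum _ fun j _ => (key j).1, sum_congr rfl fun j _ => (key j).2,
    sum_neg_distrib]
  ring
end

section
/- Let ρ ∈ ℝ satisfy 1 − ρ² − ρ⁴ > 0 and fix x_3 ∈ ℝ. Let g_{x_3} be the Gaussian density on ℝ² with mean (ρ² x_3, 0) and covariance matrix Σ̄ with rows (1 − ρ⁴, ρ), (ρ, 1), and let g be the Gaussian density on ℝ² with mean 0 and covariance Σ_1 with rows (1, ρ), (ρ, 1). Then the Kullback–Leibler divergence satisfies ∫_{ℝ²} g_{x_3}(x) log( g_{x_3}(x)/g(x) ) dx = (1/2) log( (1 − ρ²)/(1 − ρ² − ρ⁴) ) + ρ⁴ (x_3² − 1) / (2(1 − ρ²)). -/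
open MeasureTheory Matrix

/-- The Gaussian density on `ℝ^n` with mean `m` and covariance matrix `C`:
`N(m,C)(x) = (2π)^{-n/2} (det C)^{-1/2} exp(-(1/2)(x−m)ᵀ C⁻¹ (x−m))`. -/
noncomputable def gaussianDensity {n : ℕ} (m : Fin n → ℝ) (C : Matrix (Fin n) (Fin n) ℝ)
    (x : Fin n → ℝ) : ℝ :=
  (Real.sqrt ((2 * Real.pi) ^ n * C.det))⁻¹ *
    Real.exp (-(1 / 2) * ((x - m) ⬝ᵥ (C⁻¹ *ᵥ (x - m))))

theorem gaussianReal_integral_quadratic (a : ℝ) (v : NNReal) (p q r : ℝ) :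
    ∫ u, (p * u ^ 2 + q * u + r) ∂(ProbabilityTheory.gaussianReal a v) =
      p * (v + a ^ 2) + q * a + r := by
  have hL : MemLp id 2 (ProbabilityTheory.gaussianReal a v) :=
    ProbabilityTheory.memLp_id_gaussianReal 2
  have h1 : Integrable (fun u : ℝ => u) (ProbabilityTheory.gaussianReal a v) :=
    hL.integrable (by norm_num)
  have h2 : Integrable (fun u : ℝ => u ^ 2) (ProbabilityTheory.gaussianReal a v) :=
    hL.integrable_sq
  have hv := ProbabilityTheory.variance_eq_sub hL
  rw [ProbabilityTheory.variance_id_gaussianReal] at hv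
  simp only [Pi.pow_apply, id_eq, ProbabilityTheory.integral_id_gaussianReal] at hv
  have h3 : Integrable (fun u : ℝ => p * u ^ 2 + q * u) (ProbabilityTheory.gaussianReal a v) :=
    (h2.const_mul p).add (h1.const_mul q)
  rw [integral_add h3 (integrable_const r),
    integral_add (h2.const_mul p) (h1.const_mul q), integral_const_mul, integral_const_mul,
    ProbabilityTheory.integral_id_gaussianReal, integral_const]
  simp only [probReal_univ, one_smul]
  rw [hv]
  ring

theorem measurePreserving_shear (ρ : ℝ) :
    MeasurePreserving (fun p : ℝ × ℝ => (![p.2 + ρ * p.1, p.1] : Fin 2 → ℝ)) := by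
  have h1 : MeasurePreserving (fun p : ℝ × ℝ => (p.1, p.2 + ρ * p.1))
      (volume.prod volume) (volume.prod volume) := by
    refine (MeasurePreserving.id volume).skew_product
      (g := fun y u => u + ρ * y) (by fun_prop) ?_
    exact Filter.Eventually.of_forall fun y => map_add_right_eq_self volume (ρ * y)
  have h2 := (volume_preserving_finTwoArrow ℝ).symm.comp
    (Measure.measurePreserving_swap.comp h1)
  exact h2

/-- The bivariate Gaussian with second marginal `N(0, 1)` factors after shearing off the regression
of the first coordinate on the second. -/
theorem gaussianDensity_shear (a ρ : ℝ) (v : NNReal) (hv : 0 < v) (c : ℝ) (hc : c = v + ρ ^ 2)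
    (y u : ℝ) :
    gaussianDensity ![a, 0] !![c, ρ; ρ, 1] ![u + ρ * y, y] =
      ProbabilityTheory.gaussianPDFReal 0 1 y * ProbabilityTheory.gaussianPDFReal a v u := by
  have hv' : (0 : ℝ) < v := hv
  have hdet : (!![c, ρ; ρ, 1] : Matrix (Fin 2) (Fin 2) ℝ).det = v := by
    rw [det_fin_two_of, hc]; ring
  have hexp : ((![u + ρ * y, y] : Fin 2 → ℝ) - ![a, 0]) ⬝ᵥ
      ((!![c, ρ; ρ, 1] : Matrix (Fin 2) (Fin 2) ℝ)⁻¹ *ᵥ (![u + ρ * y, y] - ![a, 0])) =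
      y ^ 2 + (u - a) ^ 2 / v := by
    rw [inv_def, hdet, adjugate_fin_two_of, Ring.inverse_eq_inv', hc]
    simp [dotProduct, mulVec, Fin.sum_univ_two]
    field_simp
    ring
  rw [gaussianDensity, hdet, hexp, ProbabilityTheory.gaussianPDFReal,
    ProbabilityTheory.gaussianPDFReal, mul_mul_mul_comm, ← Real.exp_add, ← mul_inv,
    ← Real.sqrt_mul (by positivity)]
  congr 2
  · congr 1
    simp only [NNReal.coe_one]
    ring
  · simp only [NNReal.coe_one]
    field_simp
    ring

theorem log_gaussianPDFReal (a : ℝ) (v : NNReal) (hv : 0 < v) (u : ℝ) :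
    Real.log (ProbabilityTheory.gaussianPDFReal a v u) =
      -(1 / 2) * (Real.log (2 * Real.pi) + Real.log v) - (u - a) ^ 2 / (2 * v) := by
  have hv' : (0 : ℝ) < v := hv
  rw [ProbabilityTheory.gaussianPDFReal, Real.log_mul (by positivity) (by positivity),
    Real.log_exp, Real.log_inv, Real.log_sqrt (by positivity),
    Real.log_mul (by positivity) (by positivity)]
  ring

theorem continuous_gaussianDensity {n : ℕ} (m : Fin n → ℝ) (C : Matrix (Fin n) (Fin n) ℝ) :
    Continuous (gaussianDensity m C) := by
  unfold gaussianDensity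
  fun_prop

/-- The Kullback–Leibler divergence between the bivariate Gaussian with mean `(ρ²x₃, 0)`
and covariance rows `(1−ρ⁴, ρ), (ρ, 1)` and the centered bivariate Gaussian with
covariance rows `(1, ρ), (ρ, 1)` equals
`½ log((1−ρ²)/(1−ρ²−ρ⁴)) + ρ⁴(x₃²−1)/(2(1−ρ²))`. -/
theorem kl_divergence_gaussian_example_one (ρ x₃ : ℝ) (hρ : 1 - ρ ^ 2 - ρ ^ 4 > 0) :
    (∫ x : Fin 2 → ℝ,
        gaussianDensity ![ρ ^ 2 * x₃, 0] !![1 - ρ ^ 4, ρ; ρ, 1] x *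
          Real.log (gaussianDensity ![ρ ^ 2 * x₃, 0] !![1 - ρ ^ 4, ρ; ρ, 1] x /
            gaussianDensity (0 : Fin 2 → ℝ) !![1, ρ; ρ, 1] x))
      = (1 / 2) * Real.log ((1 - ρ ^ 2) / (1 - ρ ^ 2 - ρ ^ 4))
        + ρ ^ 4 * (x₃ ^ 2 - 1) / (2 * (1 - ρ ^ 2)) := by
  have hw : 0 < 1 - ρ ^ 2 := by nlinarith [sq_nonneg (ρ ^ 2)]
  obtain ⟨v, hv⟩ : ∃ v : NNReal, (v : ℝ) = 1 - ρ ^ 2 - ρ ^ 4 := ⟨⟨_, hρ.le⟩, rfl⟩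
  obtain ⟨w, hw'⟩ : ∃ w : NNReal, (w : ℝ) = 1 - ρ ^ 2 := ⟨⟨_, hw.le⟩, rfl⟩
  have hv0 : 0 < v := by rw [← NNReal.coe_pos, hv]; exact hρ
  have hw0 : 0 < w := by rw [← NNReal.coe_pos, hw']; exact hw
  have hvR : (0 : ℝ) < v := hv0
  have hwR : (0 : ℝ) < w := hw0
  have hzero : (0 : Fin 2 → ℝ) = ![0, 0] := by ext i; fin_cases i <;> rfl
  have hmeas : Measurable fun x : Fin 2 → ℝ =>
      gaussianDensity ![ρ ^ 2 * x₃, 0] !![1 - ρ ^ 4, ρ; ρ, 1] x *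
          Real.log (gaussianDensity ![ρ ^ 2 * x₃, 0] !![1 - ρ ^ 4, ρ; ρ, 1] x /
            gaussianDensity (0 : Fin 2 → ℝ) !![1, ρ; ρ, 1] x) := by
    have h1 := (continuous_gaussianDensity ![ρ ^ 2 * x₃, 0] !![1 - ρ ^ 4, ρ; ρ, 1]).measurable
    have h2 := (continuous_gaussianDensity (0 : Fin 2 → ℝ) !![1, ρ; ρ, 1]).measurable
    fun_prop
  have hT := measurePreserving_shear ρ
  rw [← hT.map_eq, integral_map hT.aemeasurable hmeas.aestronglyMeasurable]
  have hpoint : ∀ p : ℝ × ℝ,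
      gaussianDensity ![ρ ^ 2 * x₃, 0] !![1 - ρ ^ 4, ρ; ρ, 1] ![p.2 + ρ * p.1, p.1] *
          Real.log (gaussianDensity ![ρ ^ 2 * x₃, 0] !![1 - ρ ^ 4, ρ; ρ, 1]
              ![p.2 + ρ * p.1, p.1] /
            gaussianDensity (0 : Fin 2 → ℝ) !![1, ρ; ρ, 1] ![p.2 + ρ * p.1, p.1]) =
      ProbabilityTheory.gaussianPDFReal 0 1 p.1 *
        (ProbabilityTheory.gaussianPDFReal (ρ ^ 2 * x₃) v p.2 •
          ((1 / (2 * w) - 1 / (2 * v)) * p.2 ^ 2 + ρ ^ 2 * x₃ / v * p.2 +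
            ((1 / 2) * (Real.log w - Real.log v) - (ρ ^ 2 * x₃) ^ 2 / (2 * v)))) := by
    rintro ⟨y, u⟩
    have h0 := ProbabilityTheory.gaussianPDFReal_pos 0 1 y one_ne_zero
    have h1 := ProbabilityTheory.gaussianPDFReal_pos (ρ ^ 2 * x₃) v u hv0.ne'
    have h2 := ProbabilityTheory.gaussianPDFReal_pos 0 w u hw0.ne'
    rw [hzero, gaussianDensity_shear _ ρ v hv0 _ (by rw [hv]; ring),
      gaussianDensity_shear _ ρ w hw0 _ (by rw [hw']; ring), mul_div_mul_left _ _ h0.ne',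
      Real.log_div h1.ne' h2.ne', log_gaussianPDFReal _ _ hv0, log_gaussianPDFReal _ _ hw0,
      smul_eq_mul, mul_assoc]
    congr 2
    field_simp
    ring
  simp_rw [hpoint]
  rw [Measure.volume_eq_prod, integral_prod_mul (ProbabilityTheory.gaussianPDFReal 0 1)
      (fun u => ProbabilityTheory.gaussianPDFReal (ρ ^ 2 * x₃) v u •
        ((1 / (2 * (w : ℝ)) - 1 / (2 * v)) * u ^ 2 + ρ ^ 2 * x₃ / v * u +
            ((1 / 2) * (Real.log w - Real.log v) - (ρ ^ 2 * x₃) ^ 2 / (2 * v)))),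
    ProbabilityTheory.integral_gaussianPDFReal_eq_one 0 one_ne_zero,
    ← ProbabilityTheory.integral_gaussianReal_eq_integral_smul hv0.ne',
    gaussianReal_integral_quadratic, ← hv, ← hw', Real.log_div hwR.ne' hvR.ne']
  have hvw : ρ ^ 4 = w - v := by rw [hv, hw']; ring
  rw [hvw]
  field_simp
  linear_combination (v : ℝ) * x₃ ^ 2 * hvw
end
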